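/- arXiv:1802.08798 — 3 statements merged into one kernel-verified Lean document; each statement's English description precedes it below -/
import Mathlib

section
/- Let X be a measurable state space, let I be a finite index set, and for each ι ∈ I let Θ_ι be a subset of a Euclidean space ℝ^m. For each ι ∈ I and θ ∈ Θ_ι let P_{ι,θ} be a Markov kernel on X, and define D_ι(θ, θ') = sup_{x ∈ X} ‖P_{ι,θ}(x,·) − P_{ι,θ'}(x,·)‖_TV. Suppose there is a constant C < ∞ with D_ι(θ, θ') ≤ C‖θ − θ'‖ for all ι ∈ I and θ, θ' ∈ Θ_ι, and for each ι a bounded adaptation function H_ι : Θ_ι × X → Θ_ι with sup_{ι,θ,x} ‖H_ι(θ, x)‖ ≤ M < ∞. Let {γ_n} and {p_n} be deterministic sequences with γ_n → 0 and p_n ∈ (0,1), p_n → 0. Let (X_n, ι_n, θ_n) be the Auto Adapt process: given the history F_n, X_{n+1} ∼ P_{ι_n,θ_n}(X_n, ·); independently B_{n+1} ∼ Bernoulli(p_{n+1}); if B_{n+1} = 0 then ι_{n+1} = ι_n, θ_{n+1} = θ_n + γ_{c_{n+1}} H_{ι_n}(θ_n, X_{n+1}), κ_{n+1} = κ_n,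 τ_{n+1} = τ_n + 1; if B_{n+1} = 1 then a new (ι_{n+1}, θ_{n+1}) ∈ ⋃_ι {ι} × Θ_ι is chosen measurably from F_n and X_{n+1}, and κ_{n+1} = κ_n + 1, τ_{n+1} = 0; here c_n = κ_n + τ_n and κ_0 = τ_0 = 0. Then diminishing adaptation holds: Δ_{n+1} := sup_{x ∈ X} ‖P_{ι_n,θ_n}(x,·) − P_{ι_{n+1},θ_{n+1}}(x,·)‖_TV converges to zero in probability as n → ∞. -/
open MeasureTheory ProbabilityTheory Filter

/-- Total variation distance between two measures:
`‖μ − ν‖_TV = 2 · sup_{A measurable} |μ(A) − ν(A)|`. -/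
noncomputable def tvDist {X : Type*} [MeasurableSpace X] (μ ν : Measure X) : ℝ :=
  2 * ⨆ (A : Set X) (_ : MeasurableSet A), |(μ A).toReal - (ν A).toReal|

/-- **Diminishing adaptation for the Auto Adapt process (Proposition 1).**
Let `X` be a measurable state space, `I` a finite index set, and for each `ι ∈ I` let
`Θ ι ⊆ ℝ^m` be a parameter set.  For each `ι, θ` let `P ι θ` be a Markov kernel on `X`
with `D_ι(θ,θ') = sup_x ‖P_{ι,θ}(x,·) − P_{ι,θ'}(x,·)‖_TV ≤ C‖θ − θ'‖`, and let
`H ι : Θ ι × X → Θ ι` be bounded adaptation functions (`‖H ι θ x‖ ≤ M`).  Let `γ_n → 0`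
and `p_n ∈ (0,1)`, `p_n → 0` be deterministic sequences.  Let `(X_n, ι_n, θ_n)` be the
Auto Adapt process: given the history `𝔽 n`, `X_{n+1} ∼ P_{ι_n,θ_n}(X_n,·)`;
independently `B_{n+1} ∼ Bernoulli(p_{n+1})`; if `B_{n+1} = 0` then
`ι_{n+1} = ι_n`, `θ_{n+1} = θ_n + γ_{c_{n+1}} H_{ι_n}(θ_n, X_{n+1})`,
`κ_{n+1} = κ_n`, `τ_{n+1} = τ_n + 1`; if `B_{n+1} = 1` then a new `(ι_{n+1}, θ_{n+1})`
with `θ_{n+1} ∈ Θ ι_{n+1}` is chosen measurably (adaptedness), and `κ_{n+1} = κ_n + 1`,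
`τ_{n+1} = 0`; here `c_n = κ_n + τ_n`, `κ_0 = τ_0 = 0`.  Then diminishing adaptation
holds: `Δ_{n+1} = sup_x ‖P_{ι_n,θ_n}(x,·) − P_{ι_{n+1},θ_{n+1}}(x,·)‖_TV → 0`
in probability. -/
theorem auto_adapt_diminishing_adaptation
    {X : Type*} [MeasurableSpace X]
    {I : Type*} [Finite I] [MeasurableSpace I]
    {m : ℕ}
    (Θ : I → Set (EuclideanSpace ℝ (Fin m)))
    (P : I → EuclideanSpace ℝ (Fin m) → Kernel X X)
    (hPmk : ∀ i θ', IsMarkovKernel (P i θ'))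
    (C : ℝ)
    (hLip : ∀ i : I, ∀ θ₁ ∈ Θ i, ∀ θ₂ ∈ Θ i,
      (⨆ x : X, tvDist ((P i θ₁) x) ((P i θ₂) x)) ≤ C * ‖θ₁ - θ₂‖)
    (H : I → EuclideanSpace ℝ (Fin m) → X → EuclideanSpace ℝ (Fin m))
    (M : ℝ)
    (hHbdd : ∀ i θ' x, ‖H i θ' x‖ ≤ M)
    (hHmaps : ∀ (i : I), ∀ θ' ∈ Θ i, ∀ x : X, H i θ' x ∈ Θ i)
    (γ p : ℕ → ℝ)
    (hγ : Tendsto γ atTop (nhds 0))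
    (hp01 : ∀ n, p n ∈ Set.Ioo (0 : ℝ) 1)
    (hp : Tendsto p atTop (nhds 0))
    -- the Auto Adapt stochastic process
    {Ω : Type*} [MeasurableSpace Ω] (Pr : Measure Ω) [IsProbabilityMeasure Pr]
    (𝔽 : Filtration ℕ ‹MeasurableSpace Ω›)
    (Xc : ℕ → Ω → X) (ι : ℕ → Ω → I) (θ : ℕ → Ω → EuclideanSpace ℝ (Fin m))
    (B : ℕ → Ω → Bool) (κ τ : ℕ → Ω → ℕ)
    (hκ0 : ∀ ω, κ 0 ω = 0) (hτ0 : ∀ ω, τ 0 ω = 0)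
    (hΘ : ∀ n ω, θ n ω ∈ Θ (ι n ω))
    -- adaptedness: `(X_k, ι_k, θ_k)` for `k ≤ n` are part of the history `𝔽 n`
    (hXadapt : ∀ n, Measurable[𝔽 n] (Xc n))
    (hιadapt : ∀ n, Measurable[𝔽 n] (ι n))
    (hθadapt : ∀ n, Measurable[𝔽 n] (θ n))
    -- `X_{n+1} ∼ P_{ι_n,θ_n}(X_n, ·)` given the history `𝔽 n`
    (hmarkov : ∀ n (A : Set X), MeasurableSet A →
      (Pr[fun ω => A.indicator (fun _ => (1 : ℝ)) (Xc (n + 1) ω) | 𝔽 n])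
        =ᵐ[Pr] fun ω => ((P (ι n ω) (θ n ω)) (Xc n ω) A).toReal)
    -- `B_{n+1} ∼ Bernoulli(p_{n+1})`, independently of `𝔽 n` and `X_{n+1}`
    (hB : ∀ n, Pr {ω | B (n + 1) ω = true} = ENNReal.ofReal (p (n + 1)))
    (hBindep : ∀ n, ProbabilityTheory.Indep
      (MeasurableSpace.comap (B (n + 1)) inferInstance)
      ((𝔽 n) ⊔ MeasurableSpace.comap (Xc (n + 1)) inferInstance) Pr)
    -- no external adaptation: internal adaptation step
    (hupd0 : ∀ n ω, B (n + 1) ω = false →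
      ι (n + 1) ω = ι n ω ∧
      κ (n + 1) ω = κ n ω ∧ τ (n + 1) ω = τ n ω + 1 ∧
      θ (n + 1) ω = θ n ω +
        γ (κ (n + 1) ω + τ (n + 1) ω) • H (ι n ω) (θ n ω) (Xc (n + 1) ω))
    -- external adaptation: a new pair is chosen (adaptedness above), counters updated
    (hupd1 : ∀ n ω, B (n + 1) ω = true →
      κ (n + 1) ω = κ n ω + 1 ∧ τ (n + 1) ω = 0) :
    TendstoInMeasure Pr
      (fun n ω => ⨆ x : X,
        tvDist ((P (ι n ω) (θ n ω)) x) ((P (ι (n + 1) ω) (θ (n + 1) ω)) x))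
      atTop (fun _ => (0 : ℝ)) := by
  rw [tendstoInMeasure_iff_norm]
  intro ε hε
  -- choose the threshold
  have hlim : Tendsto (fun k => |C| * (|γ k| * M)) atTop (nhds 0) := by
    have h1 : Tendsto (fun k => |γ k|) atTop (nhds 0) := by simpa using hγ.abs
    simpa using (h1.mul_const M).const_mul |C|
  obtain ⟨N, hN⟩ := eventually_atTop.1 (hlim.eventually (gt_mem_nhds hε))
  rw [← tendsto_add_atTop_iff_nat N]
  have hbound : Tendsto (fun k => ∑ j ∈ Finset.range (N + 1), ENNReal.ofReal (p (k + j + 1)))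
      atTop (nhds 0) := by
    have : Tendsto (fun k => ∑ j ∈ Finset.range (N + 1), ENNReal.ofReal (p (k + j + 1)))
      atTop (nhds (∑ j ∈ Finset.range (N + 1), 0)) := by
      refine tendsto_finsetSum _ fun j _ => ?_
      have h2 : Tendsto (fun k => p (k + (j + 1))) atTop (nhds 0) :=
        (tendsto_add_atTop_iff_nat (j + 1)).2 hp
      simpa [add_assoc] using ENNReal.tendsto_ofReal h2
    simpa using this
  refine tendsto_of_tendsto_of_tendsto_of_le_of_le tendsto_const_nhds hbound
    (fun _ => zero_le) fun k => ?_
  have htau : ∀ ω L, (∀ j < L, B (k + j + 1) ω = false) → L ≤ τ (k + L) ω := by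
    intro ω L
    induction L with
    | zero => intro _; exact Nat.zero_le _
    | succ L ih =>
      intro h
      have h1 := ih fun j hj => h j (by omega)
      have h2 := (hupd0 (k + L) ω (h L (by omega))).2.2.1
      rw [← add_assoc, h2]
      omega
  refine le_trans (measure_mono (t := ⋃ j ∈ Finset.range (N + 1),
    {ω | B (k + j + 1) ω = true}) ?_) ((measure_biUnion_finset_le _ _).trans
      (Finset.sum_le_sum fun j _ => (hB (k + j)).le))
  intro ω hω
  by_contra hcon
  have hfalse : ∀ j < N + 1, B (k + j + 1) ω = false := by
    intro j hj
    by_contra hb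
    apply hcon
    simp only [Set.mem_iUnion]
    exact ⟨j, Finset.mem_range.2 hj, by simpa using hb⟩
  have ht := htau ω (N + 1) hfalse
  obtain ⟨hi, -, -, hth⟩ := hupd0 (k + N) ω (hfalse N (by omega))
  have hmem := hΘ (k + N + 1) ω
  rw [hi] at hmem
  have hL := hLip _ _ (hΘ (k + N) ω) _ hmem
  have hc := hN (κ (k + N + 1) ω + τ (k + N + 1) ω) (by rw [← add_assoc] at ht; omega)
  have hω' : ε ≤ ‖(⨆ x : X, tvDist ((P (ι (k + N) ω) (θ (k + N) ω)) x)
      ((P (ι (k + N + 1) ω) (θ (k + N + 1) ω)) x)) - 0‖ := hω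
  have htv : ∀ μ ν : Measure X, 0 ≤ tvDist μ ν := fun μ ν => mul_nonneg (by norm_num)
    (Real.iSup_nonneg fun A => Real.iSup_nonneg fun _ => abs_nonneg _)
  rw [sub_zero, hi, Real.norm_of_nonneg (Real.iSup_nonneg fun x => htv _ _)] at hω'
  have hnorm : ‖θ (k + N) ω - θ (k + N + 1) ω‖
      ≤ |γ (κ (k + N + 1) ω + τ (k + N + 1) ω)| * M := by
    rw [hth, sub_add_cancel_left, norm_neg, norm_smul, Real.norm_eq_abs]
    exact mul_le_mul_of_nonneg_left (hHbdd _ _ _) (abs_nonneg _)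
  have : C * ‖θ (k + N) ω - θ (k + N + 1) ω‖
      ≤ |C| * (|γ (κ (k + N + 1) ω + τ (k + N + 1) ω)| * M) :=
    mul_le_mul (le_abs_self C) hnorm (norm_nonneg _) (abs_nonneg _)
  linarith
end

section
/- In the setting of the Auto Adapt process of Proposition 1 (finite index set I; kernels P_{ι,θ} with D_ι(θ, θ') = sup_{x} ‖P_{ι,θ}(x,·) − P_{ι,θ'}(x,·)‖_TV ≤ C‖θ − θ'‖; adaptation functions with ‖H_ι(θ, x)‖ ≤ M for all ι, θ, x; on the event B_{n+1} = 0 the update ι_{n+1} = ι_n and θ_{n+1} = θ_n + γ_{c_{n+1}} H_{ι_n}(θ_n, X_{n+1}); B_{n+1} ∼ Bernoulli(p_{n+1}) independent of the history and of X_{n+1}), the expected adaptation displacement satisfies the quantitative bound E[Δ_{n+1}] ≤ 2 p_{n+1} + C·M·γ_{c_{n+1}}, where Δ_{n+1} = sup_{x} ‖P_{ι_n,θ_n}(x,·) − P_{ι_{n+1},θ_{n+1}}(x,·)‖_TV and c_{n+1} = κ_{n+1} + τ_{n+1}. -/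
open MeasureTheory ProbabilityTheory Filter

theorem tvDist_le_two_aux {X : Type*} [MeasurableSpace X] (μ ν : Measure X)
    [IsProbabilityMeasure μ] [IsProbabilityMeasure ν] : tvDist μ ν ≤ 2 := by
  have h : (⨆ (A : Set X) (_ : MeasurableSet A), |(μ A).toReal - (ν A).toReal|) ≤ 1 := by
    refine Real.iSup_le (fun A => Real.iSup_le (fun _ => ?_) zero_le_one) zero_le_one
    have h1 : (μ A).toReal ≤ 1 := measureReal_le_one (μ := μ) (s := A)
    have h2 : (ν A).toReal ≤ 1 := measureReal_le_one (μ := ν) (s := A)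
    have h3 : 0 ≤ (μ A).toReal := ENNReal.toReal_nonneg
    have h4 : 0 ≤ (ν A).toReal := ENNReal.toReal_nonneg
    rw [abs_le]; constructor <;> linarith
  unfold tvDist
  linarith

theorem tvDist_nonneg_aux {X : Type*} [MeasurableSpace X] (μ ν : Measure X) :
    0 ≤ tvDist μ ν := by
  unfold tvDist
  exact mul_nonneg zero_le_two
    (Real.iSup_nonneg fun A => Real.iSup_nonneg fun _ => abs_nonneg _)

/-- **Quantitative bound on the expected adaptation displacement.**
In the setting of the Auto Adapt process of Proposition 1 (finite index set `I`; kernels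
`P ι θ` with `D_ι(θ,θ') = sup_x ‖P_{ι,θ}(x,·) − P_{ι,θ'}(x,·)‖_TV ≤ C‖θ − θ'‖` on the
parameter sets `Θ ι`; adaptation functions with `‖H ι θ x‖ ≤ M`; on the event
`B_{n+1} = 0` the update `ι_{n+1} = ι_n`,
`θ_{n+1} = θ_n + γ_{c_{n+1}} H_{ι_n}(θ_n, X_{n+1})`; `B_{n+1} ∼ Bernoulli(p_{n+1})`
independent of the history and of `X_{n+1}`), the expected adaptation displacement
satisfies `E[Δ_{n+1}] ≤ 2 p_{n+1} + C·M·E[γ_{c_{n+1}}]`, where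
`Δ_{n+1} = sup_x ‖P_{ι_n,θ_n}(x,·) − P_{ι_{n+1},θ_{n+1}}(x,·)‖_TV` and
`c_{n+1} = κ_{n+1} + τ_{n+1}` (with `κ_0 = τ_0 = 0` and `κ_{n+1} = κ_n`,
`τ_{n+1} = τ_n + 1` when `B_{n+1} = 0`, `κ_{n+1} = κ_n + 1`, `τ_{n+1} = 0` when
`B_{n+1} = 1`). -/
theorem auto_adapt_expected_displacement_bound
    {X : Type*} [MeasurableSpace X]
    {I : Type*} [Finite I] [MeasurableSpace I]
    {m : ℕ}
    (Θ : I → Set (EuclideanSpace ℝ (Fin m)))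
    (P : I → EuclideanSpace ℝ (Fin m) → Kernel X X)
    (hPmk : ∀ i θ', IsMarkovKernel (P i θ'))
    (C : ℝ) (hC : 0 ≤ C)
    (hLip : ∀ i : I, ∀ θ₁ ∈ Θ i, ∀ θ₂ ∈ Θ i,
      (⨆ x : X, tvDist ((P i θ₁) x) ((P i θ₂) x)) ≤ C * ‖θ₁ - θ₂‖)
    (H : I → EuclideanSpace ℝ (Fin m) → X → EuclideanSpace ℝ (Fin m))
    (M : ℝ) (hM : 0 ≤ M)
    (hHbdd : ∀ i θ' x, ‖H i θ' x‖ ≤ M)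
    (γ p : ℕ → ℝ)
    (hγnonneg : ∀ n, 0 ≤ γ n)
    (hp01 : ∀ n, p n ∈ Set.Ioo (0 : ℝ) 1)
    -- the Auto Adapt stochastic process
    {Ω : Type*} [MeasurableSpace Ω] (Pr : Measure Ω) [IsProbabilityMeasure Pr]
    (𝔽 : Filtration ℕ ‹MeasurableSpace Ω›)
    (Xc : ℕ → Ω → X) (ι : ℕ → Ω → I) (θ : ℕ → Ω → EuclideanSpace ℝ (Fin m))
    (B : ℕ → Ω → Bool) (κ τ : ℕ → Ω → ℕ)
    (hκ0 : ∀ ω, κ 0 ω = 0) (hτ0 : ∀ ω, τ 0 ω = 0)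
    (hΘ : ∀ n ω, θ n ω ∈ Θ (ι n ω))
    (hXadapt : ∀ n, Measurable[𝔽 n] (Xc n))
    (hιadapt : ∀ n, Measurable[𝔽 n] (ι n))
    (hθadapt : ∀ n, Measurable[𝔽 n] (θ n))
    (hκmeas : ∀ n, Measurable (κ n)) (hτmeas : ∀ n, Measurable (τ n))
    (hBmeas : ∀ n, Measurable (B n))
    -- `B_{n+1} ∼ Bernoulli(p_{n+1})`, independently of `𝔽 n` and `X_{n+1}`
    (hB : ∀ n, Pr {ω | B (n + 1) ω = true} = ENNReal.ofReal (p (n + 1)))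
    (hBindep : ∀ n, ProbabilityTheory.Indep
      (MeasurableSpace.comap (B (n + 1)) inferInstance)
      ((𝔽 n) ⊔ MeasurableSpace.comap (Xc (n + 1)) inferInstance) Pr)
    -- no external adaptation: internal adaptation step
    (hupd0 : ∀ n ω, B (n + 1) ω = false →
      ι (n + 1) ω = ι n ω ∧
      κ (n + 1) ω = κ n ω ∧ τ (n + 1) ω = τ n ω + 1 ∧
      θ (n + 1) ω = θ n ω +
        γ (κ (n + 1) ω + τ (n + 1) ω) • H (ι n ω) (θ n ω) (Xc (n + 1) ω))
    -- external adaptation: counters updated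
    (hupd1 : ∀ n ω, B (n + 1) ω = true →
      κ (n + 1) ω = κ n ω + 1 ∧ τ (n + 1) ω = 0)
    -- the displacement `Δ_{n+1}` is a (measurable) random variable
    (hΔmeas : ∀ n, AEStronglyMeasurable
      (fun ω => ⨆ x : X,
        tvDist ((P (ι n ω) (θ n ω)) x) ((P (ι (n + 1) ω) (θ (n + 1) ω)) x)) Pr) :
    ∀ n : ℕ,
      (∫ ω, (⨆ x : X,
          tvDist ((P (ι n ω) (θ n ω)) x) ((P (ι (n + 1) ω) (θ (n + 1) ω)) x)) ∂Pr)
        ≤ 2 * p (n + 1) + C * M * ∫ ω, γ (κ (n + 1) ω + τ (n + 1) ω) ∂Pr := by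
  intro n
  have hc : ∀ k ω, κ k ω + τ k ω ≤ k := by
    intro k ω
    induction k with
    | zero => simp [hκ0, hτ0]
    | succ k ih =>
      cases hb : B (k + 1) ω with
      | false =>
        obtain ⟨_, h1, h2, _⟩ := hupd0 k ω hb
        omega
      | true =>
        obtain ⟨h1, h2⟩ := hupd1 k ω hb
        omega
  have hSmeas : MeasurableSet {ω | B (n + 1) ω = true} :=
    hBmeas (n + 1) (measurableSet_singleton true)
  have hγint : Integrable (fun ω => γ (κ (n + 1) ω + τ (n + 1) ω)) Pr := by
    refine Integrable.of_bound (C := ∑ j ∈ Finset.range (n + 2), γ j) ?_ ?_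
    · exact ((measurable_of_countable γ).comp
        ((hκmeas (n + 1)).add (hτmeas (n + 1)))).aestronglyMeasurable
    · refine Eventually.of_forall fun ω => ?_
      rw [Real.norm_of_nonneg (hγnonneg _)]
      refine Finset.single_le_sum (f := γ) (fun j _ => hγnonneg j) ?_
      have := hc (n + 1) ω
      simp only [Finset.mem_range]
      omega
  have hind : Integrable ({ω | B (n + 1) ω = true}.indicator (fun _ => (2 : ℝ))) Pr :=
    (integrable_const 2).indicator hSmeas
  have hpt : ∀ ω, (⨆ x : X,
      tvDist ((P (ι n ω) (θ n ω)) x) ((P (ι (n + 1) ω) (θ (n + 1) ω)) x)) ≤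
      {ω | B (n + 1) ω = true}.indicator (fun _ => (2 : ℝ)) ω
        + C * M * γ (κ (n + 1) ω + τ (n + 1) ω) := by
    intro ω
    have hg := hγnonneg (κ (n + 1) ω + τ (n + 1) ω)
    cases hb : B (n + 1) ω with
    | true =>
      have h2 : (⨆ x : X,
          tvDist ((P (ι n ω) (θ n ω)) x) ((P (ι (n + 1) ω) (θ (n + 1) ω)) x)) ≤ 2 := by
        refine Real.iSup_le (fun x => ?_) zero_le_two
        have := hPmk (ι n ω) (θ n ω)
        have := hPmk (ι (n + 1) ω) (θ (n + 1) ω)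
        exact tvDist_le_two_aux _ _
      have h3 : 0 ≤ C * M * γ (κ (n + 1) ω + τ (n + 1) ω) := by positivity
      rw [Set.indicator_of_mem (show ω ∈ {ω | B (n + 1) ω = true} from hb)]
      linarith
    | false =>
      obtain ⟨h1, _, _, h4⟩ := hupd0 n ω hb
      rw [Set.indicator_of_notMem (by simp [hb]), zero_add]
      have hmem := hΘ (n + 1) ω
      rw [h1] at hmem ⊢
      refine (hLip _ _ (hΘ n ω) _ hmem).trans ?_
      rw [mul_assoc]
      refine mul_le_mul_of_nonneg_left ?_ hC
      rw [h4, sub_add_cancel_left, norm_neg, norm_smul, Real.norm_of_nonneg hg, mul_comm]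
      exact mul_le_mul_of_nonneg_right (hHbdd _ _ _) hg
  have hnn : ∀ ω, 0 ≤ (⨆ x : X,
      tvDist ((P (ι n ω) (θ n ω)) x) ((P (ι (n + 1) ω) (θ (n + 1) ω)) x)) :=
    fun ω => Real.iSup_nonneg fun x => tvDist_nonneg_aux _ _
  refine (integral_mono_of_nonneg (Eventually.of_forall hnn)
    (hind.add (hγint.const_mul (C * M))) (Eventually.of_forall hpt)).trans (le_of_eq ?_)
  simp only [Pi.add_apply]
  rw [integral_add hind (hγint.const_mul (C * M)), integral_const_mul,
    integral_indicator_const _ hSmeas, measureReal_def, hB n,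
    ENNReal.toReal_ofReal (hp01 (n + 1)).1.le, smul_eq_mul, mul_comm (p (n + 1))]
end

section
/- (Doeblin minorization implies a uniform total-variation contraction.) Let P be a Markov kernel on a measurable space X, let m ≥ 1 be an integer, s ∈ (0,1], and let ν be a probability measure on X such that P^m(x, A) ≥ s·ν(A) for every x ∈ X and every measurable set A. Then for any two probability measures μ₁, μ₂ on X, ‖μ₁P^m − μ₂P^m‖_TV ≤ (1 − s)·‖μ₁ − μ₂‖_TV. -/
open MeasureTheory ProbabilityTheory Filter

/-- `kIter P n` is the `n`-step iterate `P^n` of the Markov kernel `P`. -/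
noncomputable def kIter {X : Type*} [MeasurableSpace X] (P : Kernel X X) : ℕ → Kernel X X
  | 0 => Kernel.id
  | n + 1 => (kIter P n) ∘ₖ P

lemma kIter_markov {X : Type*} [MeasurableSpace X] (P : Kernel X X) [IsMarkovKernel P] (n : ℕ) :
    IsMarkovKernel (kIter P n) := by
  induction n with
  | zero => unfold kIter; infer_instance
  | succ n ih => unfold kIter; infer_instance

lemma inner_eq {X : Type*} [MeasurableSpace X] (μ ν : Measure X) {A : Set X}
    (hA : MeasurableSet A) : (⨆ (_ : MeasurableSet A), |(μ A).toReal - (ν A).toReal|)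
      = |(μ A).toReal - (ν A).toReal| := by
  simp [hA]

lemma le_tv {X : Type*} [MeasurableSpace X] (μ ν : Measure X) [IsProbabilityMeasure μ]
    [IsProbabilityMeasure ν] {A : Set X} (hA : MeasurableSet A) :
    (μ A).toReal - (ν A).toReal ≤
      ⨆ (A : Set X) (_ : MeasurableSet A), |(μ A).toReal - (ν A).toReal| := by
  refine (le_abs_self _).trans ?_
  rw [← inner_eq μ ν hA]
  refine le_ciSup (f := fun A : Set X =>
    ⨆ (_ : MeasurableSet A), |(μ A).toReal - (ν A).toReal|) ⟨1, ?_⟩ A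
  rintro _ ⟨B, rfl⟩
  refine Real.iSup_le (fun _ => ?_) zero_le_one
  have h1 : (μ B).toReal ≤ 1 := measureReal_le_one (μ := μ)
  have h2 : (ν B).toReal ≤ 1 := measureReal_le_one (μ := ν)
  have h3 : 0 ≤ (μ B).toReal := ENNReal.toReal_nonneg
  have h4 : 0 ≤ (ν B).toReal := ENNReal.toReal_nonneg
  rw [abs_le]; constructor <;> linarith

lemma int_diff {X : Type*} [MeasurableSpace X] (μ ν : Measure X) [IsProbabilityMeasure μ]
    [IsProbabilityMeasure ν] (f : X → ℝ) (hf : Measurable f) (a b : ℝ)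
    (h0 : ∀ x, a ≤ f x) (h1 : ∀ x, f x ≤ b) (hab : a ≤ b) :
    ∫ x, f x ∂μ - ∫ x, f x ∂ν ≤
      (b - a) * ⨆ (A : Set X) (_ : MeasurableSet A), |(μ A).toReal - (ν A).toReal| := by
  obtain ⟨S, hS, hS1, hS2⟩ := hahn_decomposition μ ν
  have hi : ∀ (ρ : Measure X) [IsFiniteMeasure ρ], Integrable f ρ := fun ρ _ =>
    Integrable.of_mem_Icc a b hf.aemeasurable (ae_of_all _ fun x => ⟨h0 x, h1 x⟩)
  have e1 : ν.restrict S ≤ μ.restrict S := Measure.le_iff.2 fun t ht => by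
    rw [Measure.restrict_apply ht, Measure.restrict_apply ht]
    exact hS1 _ (ht.inter hS) Set.inter_subset_right
  have e2 : μ.restrict Sᶜ ≤ ν.restrict Sᶜ := Measure.le_iff.2 fun t ht => by
    rw [Measure.restrict_apply ht, Measure.restrict_apply ht]
    exact hS2 _ (ht.inter hS.compl) Set.inter_subset_right
  have k1 : ∫ x in S, (b - f x) ∂ν ≤ ∫ x in S, (b - f x) ∂μ :=
    integral_mono_measure e1 (ae_of_all _ fun x => sub_nonneg.2 (h1 x))
      ((integrable_const b).sub (hi _))
  have k2 : ∫ x in Sᶜ, (f x - a) ∂μ ≤ ∫ x in Sᶜ, (f x - a) ∂ν :=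
    integral_mono_measure e2 (ae_of_all _ fun x => sub_nonneg.2 (h0 x))
      ((hi _).sub (integrable_const a))
  rw [integral_sub (integrable_const b) (hi _), integral_sub (integrable_const b) (hi _)] at k1
  rw [integral_sub (hi _) (integrable_const a), integral_sub (hi _) (integrable_const a)] at k2
  simp only [integral_const, smul_eq_mul, measureReal_restrict_apply_univ] at k1 k2
  rw [probReal_compl_eq_one_sub hS, probReal_compl_eq_one_sub hS] at k2
  rw [← integral_add_compl hS (hi μ), ← integral_add_compl hS (hi ν)]
  have k3 := mul_le_mul_of_nonneg_left (le_tv μ ν hS) (sub_nonneg.2 hab)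
  refine le_trans ?_ k3
  change _ ≤ (b - a) * (μ.real S - ν.real S)
  nlinarith

/-- **Doeblin minorization implies a uniform total-variation contraction.**
Let `P` be a Markov kernel on `X`, `m ≥ 1` an integer, `s ∈ (0,1]`, and `ν` a
probability measure on `X` such that `P^m(x,A) ≥ s·ν(A)` for every `x ∈ X` and
measurable `A`.  Then for any two probability measures `μ₁, μ₂` on `X`,
`‖μ₁P^m − μ₂P^m‖_TV ≤ (1 − s)·‖μ₁ − μ₂‖_TV`. -/
theorem doeblin_tv_contraction
    {X : Type*} [MeasurableSpace X]
    (P : Kernel X X) [IsMarkovKernel P]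
    (m : ℕ) (hm : 1 ≤ m)
    (s : ℝ) (hs : s ∈ Set.Ioc (0 : ℝ) 1)
    (ν : Measure X) [IsProbabilityMeasure ν]
    (hmin : ∀ (x : X) (A : Set X), MeasurableSet A →
      ENNReal.ofReal s * ν A ≤ (kIter P m) x A)
    (μ₁ μ₂ : Measure X) [IsProbabilityMeasure μ₁] [IsProbabilityMeasure μ₂] :
    tvDist (μ₁.bind (fun x => (kIter P m) x)) (μ₂.bind (fun x => (kIter P m) x))
      ≤ (1 - s) * tvDist μ₁ μ₂ := by
  haveI := kIter_markov P m
  set K := kIter P m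
  have hb : ∀ (μ : Measure X) [IsProbabilityMeasure μ] (A : Set X), MeasurableSet A →
      ((μ.bind (fun x => K x)) A).toReal = ∫ x, (K x A).toReal ∂μ := by
    intro μ _ A hA
    rw [Measure.bind_apply hA K.measurable.aemeasurable, integral_toReal]
    · exact (K.measurable_coe hA).aemeasurable
    · exact ae_of_all _ fun x => measure_lt_top _ _
  have key : ∀ x A, MeasurableSet A → s * ν.real A ≤ (K x A).toReal := by
    intro x A hA
    have := ENNReal.toReal_mono (measure_ne_top _ _) (hmin x A hA)
    rwa [ENNReal.toReal_mul, ENNReal.toReal_ofReal hs.1.le] at this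
  have keyub : ∀ x A, MeasurableSet A → (K x A).toReal ≤ s * ν.real A + (1 - s) := by
    intro x A hA
    have h := key x Aᶜ hA.compl
    change _ ≤ (K x).real Aᶜ at h
    rw [probReal_compl_eq_one_sub hA, probReal_compl_eq_one_sub hA] at h
    change (K x).real A ≤ _
    linarith
  have main : ∀ (μ₁ μ₂ : Measure X) [IsProbabilityMeasure μ₁] [IsProbabilityMeasure μ₂]
      (A : Set X), MeasurableSet A →
      ∫ x, (K x A).toReal ∂μ₁ - ∫ x, (K x A).toReal ∂μ₂ ≤ (1 - s) *
        ⨆ (A : Set X) (_ : MeasurableSet A), |(μ₁ A).toReal - (μ₂ A).toReal| := by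
    intro μ₁ μ₂ _ _ A hA
    have := int_diff μ₁ μ₂ (fun x => (K x A).toReal) (K.measurable_coe hA).ennreal_toReal
      (s * ν.real A) (s * ν.real A + (1 - s)) (fun x => key x A hA) (fun x => keyub x A hA)
      (by linarith [hs.2])
    rwa [add_sub_cancel_left] at this
  unfold tvDist
  rw [mul_left_comm]
  refine mul_le_mul_of_nonneg_left ?_ zero_le_two
  have hnn : 0 ≤ (1 - s) *
        ⨆ (A : Set X) (_ : MeasurableSet A), |(μ₁ A).toReal - (μ₂ A).toReal| :=
    mul_nonneg (sub_nonneg.2 hs.2) (Real.iSup_nonneg fun A => Real.iSup_nonneg fun _ => abs_nonneg _)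
  refine Real.iSup_le (fun A => Real.iSup_le (fun hA => ?_) hnn) hnn
  rw [hb μ₁ A hA, hb μ₂ A hA, abs_le]
  have m1 := main μ₁ μ₂ A hA
  have m2 := main μ₂ μ₁ A hA
  simp only [abs_sub_comm (μ₂ _).toReal] at m2
  constructor <;> linarith
end
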